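/- arXiv:1210.7412 — 3 statements merged into one kernel-verified Lean document; each statement's English description precedes it below -/
import Mathlib

section
/- Let (E, d) be a complete separable metric space and let f : ℝ → E be continuous. Then f is (Bohr) almost periodic if and only if the set of translates {f(t + ·) : t ∈ ℝ} is relatively compact in the space of continuous functions from ℝ to E equipped with the (extended) metric of uniform convergence on ℝ. -/
open Filter Topology
open scoped UniformConvergence

/-- The translate `f (t + ·)`, as a point of the space of uniform convergence. -/
def uniformTranslate {E : Type*} (f : ℝ → E) (t : ℝ) : ℝ →ᵤ E :=
  UniformFun.ofFun (fun s => f (t + s))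

theorem UniformFun.hasBasis_uniformity_dist (α E : Type*) [PseudoMetricSpace E] :
    (uniformity (α →ᵤ E)).HasBasis (fun ε : ℝ => 0 < ε)
      (fun ε => {p | ∀ x, dist (UniformFun.toFun p.1 x) (UniformFun.toFun p.2 x) < ε}) :=
  UniformFun.hasBasis_uniformity_of_basis α E Metric.uniformity_basis_dist

/-- A continuous function with relatively dense almost periods is uniformly continuous. -/
theorem uniformContinuous_of_almostPeriodic {E : Type*} [PseudoMetricSpace E]
    {f : ℝ → E} (hf : Continuous f)
    (h : ∀ ε > 0, ∃ ℓ > 0, ∀ a : ℝ, ∃ τ ∈ Set.Icc a (a + ℓ),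
        ∀ t : ℝ, dist (f (t + τ)) (f t) < ε) :
    UniformContinuous f := by
  rw [Metric.uniformContinuous_iff]
  intro ε hε
  obtain ⟨ℓ, -, hℓ⟩ := h (ε / 3) (by positivity)
  have huc : UniformContinuousOn f (Set.Icc (-1) (ℓ + 1)) :=
    isCompact_Icc.uniformContinuousOn_of_continuous hf.continuousOn
  obtain ⟨δ, hδ, hd⟩ := Metric.uniformContinuousOn_iff.1 huc (ε / 3) (by positivity)
  refine ⟨min δ 1, by positivity, fun {s t} hst => ?_⟩
  obtain ⟨hst₁, hst₂⟩ := lt_min_iff.1 hst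
  obtain ⟨τ, ⟨hτ₁, hτ₂⟩, hτ⟩ := hℓ (-s)
  rw [Real.dist_eq, abs_lt] at hst₂
  have hmid := hd (s + τ) ⟨by linarith, by linarith⟩ (t + τ)
    ⟨by linarith, by linarith⟩ (by rwa [dist_add_right])
  have hs := hτ s
  have ht := hτ t
  rw [dist_comm] at hs
  linarith [dist_triangle4 (f s) (f (s + τ)) (f (t + τ)) (f t)]

theorem continuous_uniformTranslate {E : Type*} [PseudoMetricSpace E]
    {f : ℝ → E} (hf : UniformContinuous f) : Continuous (uniformTranslate f) := by
  apply UniformContinuous.continuous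
  rw [Metric.uniformity_basis_dist.uniformContinuous_iff
    (UniformFun.hasBasis_uniformity_dist ℝ E)]
  intro ε hε
  obtain ⟨δ, hδ, hd⟩ := Metric.uniformContinuous_iff.1 hf ε hε
  exact ⟨δ, hδ, fun s t hst x => hd (by simpa [dist_add_right] using hst)⟩

theorem totallyBounded_range_uniformTranslate {E : Type*} [PseudoMetricSpace E]
    {f : ℝ → E} (hf : Continuous f)
    (h : ∀ ε > 0, ∃ ℓ > 0, ∀ a : ℝ, ∃ τ ∈ Set.Icc a (a + ℓ),
        ∀ t : ℝ, dist (f (t + τ)) (f t) < ε) :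
    TotallyBounded (Set.range (uniformTranslate f)) := by
  have hcont := continuous_uniformTranslate (uniformContinuous_of_almostPeriodic hf h)
  rw [(UniformFun.hasBasis_uniformity_dist ℝ E).totallyBounded_iff]
  intro ε hε
  obtain ⟨ℓ, -, hℓ⟩ := h (ε / 2) (by positivity)
  have htb := ((isCompact_Icc (a := (0 : ℝ)) (b := ℓ)).image hcont).totallyBounded
  obtain ⟨c, hc, hcover⟩ := (UniformFun.hasBasis_uniformity_dist ℝ E).totallyBounded_iff.1
    htb (ε / 2) (by positivity)
  refine ⟨c, hc, ?_⟩
  rintro _ ⟨t, rfl⟩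
  obtain ⟨τ, ⟨hτ₁, hτ₂⟩, hτ⟩ := hℓ (-t)
  obtain ⟨g, hg, hgd⟩ := Set.mem_iUnion₂.1
    (hcover ⟨t + τ, ⟨by linarith, by linarith⟩, rfl⟩)
  refine Set.mem_iUnion₂.2 ⟨g, hg, fun x => ?_⟩
  have h₁ : dist (f (t + τ + x)) (UniformFun.toFun g x) < ε / 2 := hgd x
  have h₂ := hτ (t + x)
  rw [dist_comm, add_right_comm] at h₂
  change dist (f (t + x)) (UniformFun.toFun g x) < ε
  linarith [dist_triangle (f (t + x)) (f (t + τ + x)) (UniformFun.toFun g x)]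

theorem almostPeriodic_of_totallyBounded {E : Type*} [PseudoMetricSpace E] {f : ℝ → E}
    (h : TotallyBounded (Set.range (uniformTranslate f))) :
    ∀ ε > 0, ∃ ℓ > 0, ∀ a : ℝ, ∃ τ ∈ Set.Icc a (a + ℓ),
        ∀ t : ℝ, dist (f (t + τ)) (f t) < ε := by
  intro ε hε
  obtain ⟨c, hcs, hc, hcover⟩ := totallyBounded_iff_subset.1 h _
    ((UniformFun.hasBasis_uniformity_dist ℝ E).mem_of_mem hε)
  have hex : ∀ g ∈ c, ∃ t, uniformTranslate f t = g := fun g hg => hcs hg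
  choose! u hu using hex
  obtain ⟨M, hM⟩ := (hc.image fun g => |u g|).bddAbove
  refine ⟨2 * |M| + 1, by positivity, fun a => ?_⟩
  obtain ⟨g, hg, hgd⟩ := Set.mem_iUnion₂.1 (hcover ⟨a + |M|, rfl⟩)
  have hb := abs_le.1 ((hM ⟨g, hg, rfl⟩).trans (le_abs_self M))
  refine ⟨a + |M| - u g, ⟨by linarith [hb.2], by linarith [hb.1]⟩, fun t => ?_⟩
  have hx : dist (f (a + |M| + (t - u g))) (UniformFun.toFun g (t - u g)) < ε :=
    hgd (t - u g)
  have hg' : UniformFun.toFun g (t - u g) = f (u g + (t - u g)) :=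
    congrArg (fun k => UniformFun.toFun k (t - u g)) (hu g hg).symm
  rw [hg'] at hx
  convert hx using 3 <;> ring

/-- A continuous function `f : ℝ → E` into a complete separable metric space is
Bohr almost periodic if and only if the set of its translates is relatively compact
in `ℝ →ᵤ E`, the space of functions endowed with the uniform structure (metric) of
uniform convergence on `ℝ`. -/
theorem bohr_almost_periodic_iff_translates_relatively_compact
    {E : Type*} [MetricSpace E] [CompleteSpace E] [TopologicalSpace.SeparableSpace E]
    (f : ℝ → E) (hf : Continuous f) :
    (∀ ε > 0, ∃ ℓ > 0, ∀ a : ℝ, ∃ τ ∈ Set.Icc a (a + ℓ),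
        ∀ t : ℝ, dist (f (t + τ)) (f t) < ε) ↔
      IsCompact (closure
        {g : ℝ →ᵤ E | ∃ t : ℝ, g = UniformFun.ofFun (fun s => f (t + s))}) := by
  have hrange : {g : ℝ →ᵤ E | ∃ t : ℝ, g = UniformFun.ofFun (fun s => f (t + s))} =
      Set.range (uniformTranslate f) :=
    Set.ext fun g => exists_congr fun t => eq_comm
  rw [hrange]
  exact ⟨fun h => (totallyBounded_range_uniformTranslate hf h).closure.isCompact_of_isClosed
      isClosed_closure,
    fun h => almostPeriodic_of_totallyBounded (h.totallyBounded.subset subset_closure)⟩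
end

section
/- Let (E, d) be a complete separable metric space and let f : ℝ → E be continuous. Then f is (Bohr) almost periodic if and only if f satisfies Bochner's double sequence criterion: for every pair of sequences (α'_n) ⊂ ℝ and (β'_n) ⊂ ℝ there exist subsequences (α_n) ⊂ (α'_n) and (β_n) ⊂ (β'_n), extracted with the same indexes, such that for every t ∈ ℝ the iterated limit lim_{n→∞} lim_{m→∞} f(t + α_n + β_m) and the diagonal limit lim_{n→∞} f(t + α_n + β_n) both exist in E and are equal. -/
open Filter Topology

open scoped UniformConvergence

section AlmostPeriodic

variable {E : Type*} [MetricSpace E] {f : ℝ → E}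

/-- A continuous Bohr almost periodic function is uniformly continuous. -/
theorem uniformContinuous_of_bohr (hf : Continuous f)
    (h : ∀ ε > 0, ∃ ℓ > 0, ∀ a : ℝ, ∃ τ ∈ Set.Icc a (a + ℓ),
      ∀ t : ℝ, dist (f (t + τ)) (f t) < ε) : UniformContinuous f := by
  rw [Metric.uniformContinuous_iff]
  intro ε hε
  obtain ⟨ℓ, -, hτ⟩ := h (ε / 3) (by positivity)
  have huc := (isCompact_Icc (a := (-1 : ℝ)) (b := ℓ + 1)).uniformContinuousOn_of_continuous
    hf.continuousOn
  obtain ⟨δ, hδ, hfδ⟩ := Metric.uniformContinuousOn_iff.1 huc (ε / 3) (by positivity)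
  refine ⟨min δ 1, by positivity, fun x y hxy => ?_⟩
  obtain ⟨τ, ⟨hτ₁, hτ₂⟩, hper⟩ := hτ (-x)
  have hxy₁ := abs_lt.1 (Real.dist_eq x y ▸ hxy.trans_le (min_le_right _ _))
  have key := hfδ (x + τ) ⟨by linarith, by linarith⟩ (y + τ)
    ⟨by linarith [hxy₁.2], by linarith [hxy₁.1]⟩
    (by simpa using hxy.trans_le (min_le_left _ _))
  have hx := hper x
  rw [dist_comm] at hx
  linarith [hper y, dist_triangle4 (f x) (f (x + τ)) (f (y + τ)) (f y)]

/-- The translates of a continuous Bohr almost periodic function form a totally bounded set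
for uniform convergence. -/
theorem totallyBounded_translates_of_bohr (hf : Continuous f)
    (h : ∀ ε > 0, ∃ ℓ > 0, ∀ a : ℝ, ∃ τ ∈ Set.Icc a (a + ℓ),
      ∀ t : ℝ, dist (f (t + τ)) (f t) < ε) :
    TotallyBounded (Set.range fun s : ℝ => UniformFun.ofFun fun t : ℝ => f (t + s)) := by
  rw [(UniformFun.hasBasis_uniformity_of_basis ℝ E
    Metric.uniformity_basis_dist).totallyBounded_iff]
  intro ε hε
  obtain ⟨ℓ, -, hτ⟩ := h (ε / 2) (by positivity)
  obtain ⟨δ, hδ, hfδ⟩ := Metric.uniformContinuous_iff.1 (uniformContinuous_of_bohr hf h)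
    (ε / 2) (by positivity)
  obtain ⟨T, -, hT, hcov⟩ := (isCompact_Icc (a := (0 : ℝ)) (b := ℓ)).finite_cover_balls hδ
  refine ⟨(fun s : ℝ => UniformFun.ofFun fun t : ℝ => f (t + s)) '' T, hT.image _, ?_⟩
  rintro _ ⟨s, rfl⟩
  obtain ⟨τ, ⟨hτ₁, hτ₂⟩, hper⟩ := hτ (s - ℓ)
  have hmem : s - τ ∈ Set.Icc 0 ℓ := ⟨by linarith, by linarith⟩
  obtain ⟨s', hs', hdist⟩ := Set.mem_iUnion₂.1 (hcov hmem)
  refine Set.mem_iUnion₂.2 ⟨_, ⟨s', hs', rfl⟩, fun t => ?_⟩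
  have hnear : dist (f (t + (s - τ))) (f (t + s')) < ε / 2 := hfδ (by simpa using hdist)
  have hshift := hper (t + (s - τ))
  rw [show t + (s - τ) + τ = t + s by ring] at hshift
  change dist (f (t + s)) (f (t + s')) < ε
  linarith [dist_triangle (f (t + s)) (f (t + (s - τ))) (f (t + s'))]

/-- If translates of `f` along `α` form a Cauchy sequence for uniform convergence, then they are
uniformly close in the metric of `E`. -/
theorem forall_dist_translate_lt_of_cauchySeq {α : ℕ → ℝ}
    (h : CauchySeq fun n => UniformFun.ofFun fun t : ℝ => f (t + α n)) {ε : ℝ} (hε : 0 < ε) :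
    ∃ N, ∀ m ≥ N, ∀ n ≥ N, ∀ t, dist (f (t + α m)) (f (t + α n)) < ε :=
  (UniformFun.hasBasis_uniformity_of_basis ℝ E
    Metric.uniformity_basis_dist).cauchySeq_iff.1 h ε hε

/-- If the translates of `f` along `α` and along `β` are Cauchy for uniform convergence, then the
iterated and the diagonal limits of `f (t + α n + β m)` exist and agree. -/
theorem exists_iterated_limit_eq_diagonal_limit [CompleteSpace E] {α β : ℕ → ℝ}
    (hα : CauchySeq fun n => UniformFun.ofFun fun t : ℝ => f (t + α n))
    (hβ : CauchySeq fun n => UniformFun.ofFun fun t : ℝ => f (t + β n)) (t : ℝ) :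
    ∃ (u : ℕ → E) (l : E), (∀ n, Tendsto (fun m => f (t + α n + β m)) atTop (𝓝 (u n))) ∧
      Tendsto u atTop (𝓝 l) ∧ Tendsto (fun n => f (t + α n + β n)) atTop (𝓝 l) := by
  have hinner : ∀ n, ∃ x, Tendsto (fun m => f (t + α n + β m)) atTop (𝓝 x) := by
    refine fun n => cauchySeq_tendsto_of_complete (Metric.cauchySeq_iff.2 fun ε hε => ?_)
    obtain ⟨N, hN⟩ := forall_dist_translate_lt_of_cauchySeq hβ hε
    exact ⟨N, fun m hm k hk => hN m hm k hk _⟩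
  choose u hu using hinner
  have hdiag : CauchySeq fun n => f (t + α n + β n) := by
    refine Metric.cauchySeq_iff.2 fun ε hε => ?_
    obtain ⟨N, hN⟩ := forall_dist_translate_lt_of_cauchySeq hα (half_pos hε)
    obtain ⟨M, hM⟩ := forall_dist_translate_lt_of_cauchySeq hβ (half_pos hε)
    refine ⟨max N M, fun m hm k hk => ?_⟩
    have hmove := hN m (le_of_max_le_left hm) k (le_of_max_le_left hk) (t + β m)
    rw [add_right_comm t (β m), add_right_comm t (β m)] at hmove
    linarith [hM m (le_of_max_le_right hm) k (le_of_max_le_right hk) (t + α k),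
      dist_triangle (f (t + α m + β m)) (f (t + α k + β m)) (f (t + α k + β k))]
  obtain ⟨l, hl⟩ := cauchySeq_tendsto_of_complete hdiag
  refine ⟨u, l, hu, ?_, hl⟩
  refine hl.congr_dist (Metric.tendsto_atTop.2 fun ε hε => ?_)
  obtain ⟨N, hN⟩ := forall_dist_translate_lt_of_cauchySeq hβ (half_pos hε)
  refine ⟨N, fun n hn => ?_⟩
  have hle : dist (f (t + α n + β n)) (u n) ≤ ε / 2 :=
    le_of_tendsto (tendsto_const_nhds.dist (hu n))
      (eventually_atTop.2 ⟨N, fun m hm => (hN n hn m hm _).le⟩)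
  rw [Real.dist_0_eq_abs, abs_of_nonneg dist_nonneg]
  linarith

/-- If `f` is not Bohr almost periodic, then some sequence of translates of `f` is separated
for uniform convergence. -/
theorem exists_separated_translates
    (h : ¬ ∀ ε > 0, ∃ ℓ > 0, ∀ a : ℝ, ∃ τ ∈ Set.Icc a (a + ℓ),
      ∀ t : ℝ, dist (f (t + τ)) (f t) < ε) :
    ∃ ε > 0, ∃ α : ℕ → ℝ, ∀ m n, m < n → ∃ t, ε ≤ dist (f (t + α m)) (f (t + α n)) := by
  push Not at h
  obtain ⟨ε, hε, h⟩ := h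
  refine ⟨ε, hε, ?_⟩
  obtain ⟨α, -, hα⟩ := exists_seq_of_forall_finset_exists (fun _ : ℝ => True)
    (fun x y => ∃ t, ε ≤ dist (f (t + x)) (f (t + y))) fun s _ => by
      have hbdd : ∃ L > 0, ∀ x ∈ s, |x| ≤ L := by
        refine ⟨∑ x ∈ s, |x| + 1, by positivity, fun x hx => ?_⟩
        linarith [Finset.single_le_sum (f := fun x : ℝ => |x|) (fun i _ => abs_nonneg i) hx]
      obtain ⟨L, hL, hs⟩ := hbdd
      obtain ⟨a, ha⟩ := h (2 * L) (by positivity)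
      refine ⟨a + L, trivial, fun x hx => ?_⟩
      obtain ⟨hx₁, hx₂⟩ := abs_le.1 (hs x hx)
      obtain ⟨t, ht⟩ := ha (a + L - x) ⟨by linarith, by linarith⟩
      refine ⟨t - x, ?_⟩
      rwa [sub_add_cancel, dist_comm, show t - x + (a + L) = t + (a + L - x) by ring]
  exact ⟨α, hα⟩

/-- Bochner's double sequence criterion implies Bohr almost periodicity. -/
theorem bohr_of_bochner_double_sequence
    (h : ∀ α' β' : ℕ → ℝ, ∃ φ : ℕ → ℕ, StrictMono φ ∧
      ∀ t : ℝ, ∃ (u : ℕ → E) (l : E),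
        (∀ n : ℕ, Tendsto (fun m : ℕ => f (t + α' (φ n) + β' (φ m))) atTop (𝓝 (u n))) ∧
        Tendsto u atTop (𝓝 l) ∧
        Tendsto (fun n : ℕ => f (t + α' (φ n) + β' (φ n))) atTop (𝓝 l)) :
    ∀ ε > 0, ∃ ℓ > 0, ∀ a : ℝ, ∃ τ ∈ Set.Icc a (a + ℓ),
      ∀ t : ℝ, dist (f (t + τ)) (f t) < ε := by
  by_contra hbohr
  obtain ⟨ε, hε, α, hα⟩ := exists_separated_translates hbohr
  obtain ⟨φ, hφ, hlim⟩ := h 0 α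
  have hpt : ∀ t, ∃ x, Tendsto (fun m => f (t + α (φ m))) atTop (𝓝 x) := fun t => by
    obtain ⟨u, -, hu, -⟩ := hlim t
    exact ⟨u 0, by simpa using hu 0⟩
  choose g hg using hpt
  choose s hs using fun k => hα (φ k) (φ (k + 1)) (hφ k.lt_succ_self)
  obtain ⟨ψ, hψ, hlimψ⟩ := h s fun k => α (φ k)
  obtain ⟨θ, hθ, hlimθ⟩ := h (fun k => s (ψ k)) fun k => α (φ (ψ k + 1))
  obtain ⟨u, l, hu, hul, hl⟩ := hlimψ 0
  obtain ⟨v, l', hv, hvl, hl'⟩ := hlimθ 0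
  have hu' : ∀ n, u n = g (0 + s (ψ n)) := fun n =>
    tendsto_nhds_unique (hu n) ((hg _).comp hψ.tendsto_atTop)
  have hv' : ∀ n, v n = g (0 + s (ψ (θ n))) := fun n =>
    tendsto_nhds_unique (hv n)
      ((hg _).comp ((tendsto_add_atTop_nat 1).comp (hψ.comp hθ).tendsto_atTop))
  have huv : v = u ∘ θ := funext fun n => (hv' n).trans (hu' (θ n)).symm
  have hll : l' = l := tendsto_nhds_unique hvl (huv ▸ hul.comp hθ.tendsto_atTop)
  have hdist := (hl.comp hθ.tendsto_atTop).dist (hll ▸ hl')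
  rw [dist_self] at hdist
  refine hε.not_ge (ge_of_tendsto' hdist fun n => ?_)
  simpa using hs (ψ (θ n))

end AlmostPeriodic

/-- Bochner's criterion: a continuous function `f : ℝ → E` into a complete separable
metric space is Bohr almost periodic if and only if, for every pair of sequences
`α'`, `β'` of reals, one can extract subsequences (with the same indexes, given by a
strictly monotone `φ : ℕ → ℕ`) such that for every `t ∈ ℝ` the iterated limit
`lim_n lim_m f (t + α n + β m)` and the diagonal limit `lim_n f (t + α n + β n)`
both exist and are equal. -/
theorem bohr_almost_periodic_iff_bochner_double_sequence
    {E : Type*} [MetricSpace E] [CompleteSpace E] [TopologicalSpace.SeparableSpace E]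
    (f : ℝ → E) (hf : Continuous f) :
    (∀ ε > 0, ∃ ℓ > 0, ∀ a : ℝ, ∃ τ ∈ Set.Icc a (a + ℓ),
        ∀ t : ℝ, dist (f (t + τ)) (f t) < ε) ↔
      (∀ α' β' : ℕ → ℝ, ∃ φ : ℕ → ℕ, StrictMono φ ∧
        ∀ t : ℝ, ∃ (u : ℕ → E) (l : E),
          (∀ n : ℕ, Tendsto (fun m : ℕ => f (t + α' (φ n) + β' (φ m))) atTop (𝓝 (u n))) ∧
          Tendsto u atTop (𝓝 l) ∧
          Tendsto (fun n : ℕ => f (t + α' (φ n) + β' (φ n))) atTop (𝓝 l)) := by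
  refine ⟨fun h α' β' => ?_, bohr_of_bochner_double_sequence⟩
  let F : ℝ → ℝ →ᵤ E := fun s => UniformFun.ofFun fun t => f (t + s)
  have hK : IsCompact (closure (Set.range F)) :=
    (totallyBounded_translates_of_bohr hf h).closure.isCompact_of_isClosed
      isClosed_closure
  have hmem : ∀ s, F s ∈ closure (Set.range F) := fun s => subset_closure ⟨s, rfl⟩
  obtain ⟨p, -, φ, hφ, hp⟩ := (hK.prod hK).tendsto_subseq
    (x := fun n => (F (α' n), F (β' n))) fun n => ⟨hmem _, hmem _⟩
  exact ⟨φ, hφ, exists_iterated_limit_eq_diagonal_limit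
    (α := α' ∘ φ) (β := β' ∘ φ) hp.fst_nhds.cauchySeq hp.snd_nhds.cauchySeq⟩
end

section
/- Let H₂ be a separable Hilbert space and (Ω, 𝓕, P) a probability space. Let F : ℝ × H₂ → H₂ be continuous, almost periodic in t uniformly with respect to x in compact subsets of H₂, and satisfy ‖F(t,x)‖ ≤ C₁(1 + ‖x‖) and ‖F(t,x) − F(t,y)‖ ≤ C₂‖x − y‖ for all t ∈ ℝ and x, y ∈ H₂. Then the induced Nemytskii map 𝐹 : ℝ × L²(Ω; H₂) → L²(Ω; H₂), 𝐹(t, Y)(ω) = F(t, Y(ω)), is square-mean almost periodic uniformly with respect to Y in compact subsets of L²(Ω; H₂): for every ε > 0 and every compact set 𝒞 ⊆ L²(Ω; H₂) there exists ℓ(ε, 𝒞) > 0 such that every interval of length ℓ(ε, 𝒞) contains a number τ with sup_{t∈ℝ} sup_{Y∈𝒞} E‖F(t+τ, Y) − F(t, Y)‖² < ε. -/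
open Filter Topology MeasureTheory

/-- The square of the `L²` norm is the integral of the squared pointwise norm. -/
theorem MeasureTheory.L2.integral_norm_sq_eq_norm_sq {H Ω : Type*} [NormedAddCommGroup H]
    [InnerProductSpace ℝ H] [MeasurableSpace Ω] {μ : Measure Ω} (Y : Lp H 2 μ) :
    ∫ ω, ‖Y ω‖ ^ 2 ∂μ = ‖Y‖ ^ 2 := by
  rw [← real_inner_self_eq_norm_sq, L2.inner_def]
  simp only [real_inner_self_eq_norm_sq]

/-- A compact subset of `Lᵖ` is covered by finitely many balls of a given radius centred at
simple functions; the values of those simple functions form a finite set. -/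
theorem IsCompact.exists_finite_simpleFunc_approx {H Ω : Type*} [NormedAddCommGroup H]
    [MeasurableSpace Ω] {μ : Measure Ω} {p : ENNReal} [Fact (1 ≤ p)] (hp : p ≠ ⊤)
    {𝒞 : Set (Lp H p μ)} (h𝒞 : IsCompact 𝒞) {δ : ℝ} (hδ : 0 < δ) :
    ∃ K : Set H, K.Finite ∧ ∀ Y ∈ 𝒞, ∃ S : Lp H p μ, ‖Y - S‖ < δ ∧ ∀ᵐ ω ∂μ, S ω ∈ K := by
  obtain ⟨T, hT⟩ := h𝒞.elim_finite_subcover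
    (fun S : Lp.simpleFunc H p μ => Metric.ball (S : Lp H p μ) δ)
    (fun _ => Metric.isOpen_ball) fun Y _ => by
      obtain ⟨S, hS⟩ := (Lp.simpleFunc.denseRange (E := H) (μ := μ) hp).exists_dist_lt Y hδ
      exact Set.mem_iUnion.2 ⟨S, hS⟩
  refine ⟨⋃ S ∈ T, Set.range (Lp.simpleFunc.toSimpleFunc S),
    T.finite_toSet.biUnion fun S _ => (Lp.simpleFunc.toSimpleFunc S).finite_range,
    fun Y hY => ?_⟩
  obtain ⟨S, hST, hS⟩ := Set.mem_iUnion₂.1 (hT hY)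
  refine ⟨S, by simpa [dist_eq_norm] using hS, ?_⟩
  filter_upwards [Lp.simpleFunc.toSimpleFunc_eq_toFun S] with ω hω
  exact Set.mem_iUnion₂.2 ⟨S, hST, ω, hω⟩

/-- If `F : ℝ × H₂ → H₂` is continuous, almost periodic in `t` uniformly with respect
to `x` in compact subsets of `H₂`, of linear growth and Lipschitz in `x` (uniformly in
`t`), then the induced Nemytskii map `𝐹(t,Y)(ω) = F(t, Y(ω))` is square-mean almost
periodic uniformly with respect to `Y` in compact subsets of `L²(Ω; H₂)`. -/
theorem nemytskii_map_square_mean_almost_periodic_uniformly_on_compacts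
    {H₂ : Type*} [NormedAddCommGroup H₂] [InnerProductSpace ℝ H₂]
    [CompleteSpace H₂] [TopologicalSpace.SeparableSpace H₂]
    [MeasurableSpace H₂] [BorelSpace H₂]
    {Ω : Type*} [MeasurableSpace Ω] (μ : Measure Ω) [IsProbabilityMeasure μ]
    (F : ℝ → H₂ → H₂) (C₁ C₂ : ℝ)
    (hFcont : Continuous (fun p : ℝ × H₂ => F p.1 p.2))
    (hFap : ∀ ε > 0, ∀ K : Set H₂, IsCompact K → ∃ ℓ > 0, ∀ a : ℝ,
        ∃ τ ∈ Set.Icc a (a + ℓ), ∀ t : ℝ, ∀ x ∈ K, ‖F (t + τ) x - F t x‖ < ε)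
    (hFgrowth : ∀ (t : ℝ) (x : H₂), ‖F t x‖ ≤ C₁ * (1 + ‖x‖))
    (hFlip : ∀ (t : ℝ) (x y : H₂), ‖F t x - F t y‖ ≤ C₂ * ‖x - y‖) :
    ∀ ε > 0, ∀ 𝒞 : Set (Lp H₂ 2 μ), IsCompact 𝒞 → ∃ ℓ > 0, ∀ a : ℝ,
      ∃ τ ∈ Set.Icc a (a + ℓ), ∀ t : ℝ, ∀ Y ∈ 𝒞,
        ∫ ω, ‖F (t + τ) (Y ω) - F t (Y ω)‖ ^ 2 ∂μ < ε := by
  intro ε hε 𝒞 h𝒞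
  have hC : 0 < C₂ ^ 2 + 1 := by positivity
  obtain ⟨δ, hδ, hδε⟩ : ∃ δ > 0, 8 * C₂ ^ 2 * δ ^ 2 < ε / 2 := by
    refine ⟨√(ε / (16 * (C₂ ^ 2 + 1))), by positivity, ?_⟩
    rw [Real.sq_sqrt (by positivity), ← mul_div_assoc, div_lt_iff₀ (by positivity)]
    nlinarith
  obtain ⟨η, hη, hηε⟩ : ∃ η > 0, 2 * η ^ 2 = ε / 2 :=
    ⟨√(ε / 4), by positivity, by rw [Real.sq_sqrt (by positivity)]; ring⟩
  obtain ⟨K, hK, hKapprox⟩ := h𝒞.exists_finite_simpleFunc_approx (by simp) hδ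
  obtain ⟨ℓ, hℓ, hℓτ⟩ := hFap η hη K hK.isCompact
  refine ⟨ℓ, hℓ, fun a => ?_⟩
  obtain ⟨τ, hτ, hτF⟩ := hℓτ a
  refine ⟨τ, hτ, fun t Y hY => ?_⟩
  obtain ⟨S, hYS, hSK⟩ := hKapprox Y hY
  have hint : Integrable (fun ω => 8 * C₂ ^ 2 * ‖(Y - S) ω‖ ^ 2) μ :=
    ((Lp.memLp (Y - S)).integrable_norm_pow (by simp)).const_mul _
  have hle : ∀ᵐ ω ∂μ, ‖F (t + τ) (Y ω) - F t (Y ω)‖ ^ 2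
      ≤ 8 * C₂ ^ 2 * ‖(Y - S) ω‖ ^ 2 + 2 * η ^ 2 := by
    filter_upwards [hSK, Lp.coeFn_sub Y S] with ω hω hsub
    rw [hsub, Pi.sub_apply]
    have htri : ‖F (t + τ) (Y ω) - F t (Y ω)‖ ≤ 2 * (C₂ * ‖Y ω - S ω‖) + η := by
      have h₁ := norm_sub_le_norm_sub_add_norm_sub (F (t + τ) (Y ω)) (F (t + τ) (S ω)) (F t (Y ω))
      have h₂ := norm_sub_le_norm_sub_add_norm_sub (F (t + τ) (S ω)) (F t (S ω)) (F t (Y ω))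
      have h₃ := hFlip t (S ω) (Y ω)
      rw [norm_sub_rev (S ω)] at h₃
      linarith [hFlip (t + τ) (Y ω) (S ω), hτF t _ hω]
    calc _ ≤ (2 * (C₂ * ‖Y ω - S ω‖) + η) ^ 2 := by gcongr
      _ ≤ 2 * ((2 * (C₂ * ‖Y ω - S ω‖)) ^ 2 + η ^ 2) := add_sq_le
      _ = _ := by ring
  calc ∫ ω, ‖F (t + τ) (Y ω) - F t (Y ω)‖ ^ 2 ∂μ
      ≤ ∫ ω, (8 * C₂ ^ 2 * ‖(Y - S) ω‖ ^ 2 + 2 * η ^ 2) ∂μ :=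
        integral_mono_of_nonneg (.of_forall fun _ => by positivity)
          (hint.add (integrable_const _)) hle
    _ = 8 * C₂ ^ 2 * ‖Y - S‖ ^ 2 + 2 * η ^ 2 := by
        rw [integral_add hint (integrable_const _), integral_const_mul,
          L2.integral_norm_sq_eq_norm_sq]
        simp
    _ ≤ 8 * C₂ ^ 2 * δ ^ 2 + 2 * η ^ 2 := by gcongr
    _ < ε := by linarith
end
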